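/- Let a, ρ ∈ ℂ and N ∈ ℕ, and assume (a+ρ)ⱼ ≠ 0 for all 0 ≤ j ≤ N and (1−a−N+ρ)ₗ ≠ 0 for all 0 ≤ ℓ ≤ N. For 0 ≤ k ≤ N and ℓ ∈ ℕ define the Hahn polynomial value Qₖ(ℓ) = Σ_{j=0}^{k} [ (−k)ⱼ · (−ℓ)ⱼ · (k+2a−1)ⱼ ] / [ (a+ρ)ⱼ · (−N)ⱼ · j! ]. Define aₖ(x) = (x+a)ₖ·(x+1−a−N)_{N−k} and cₗ(x) = (ρ−x)ₗ. Then for every 0 ≤ k ≤ N and all x ∈ ℂ, aₖ(x) = (a+ρ)ₖ · (1−a−N+ρ)_{N−k} · Σ_{ℓ=0}^{N} [ (−N)ₗ / ( ℓ! · (1−a−N+ρ)ₗ ) ] · Qₖ(ℓ) · cₗ(x). -/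

import Mathlib

/-- The Pochhammer symbol `(z)ₘ = z (z+1) ⋯ (z+m-1)`. -/
noncomputable def poch (z : ℂ) (m : ℕ) : ℂ := ∏ i ∈ Finset.range m, (z + i)

/-- The Hahn polynomial
`Qₖ(ℓ) = ₃F₂(-k, -ℓ, k+2a-1 ; a+ρ, -N ; 1)
       = Σ_{j=0}^{k} (-k)ⱼ (-ℓ)ⱼ (k+2a-1)ⱼ / ((a+ρ)ⱼ (-N)ⱼ j!)`. -/
noncomputable def hahnQ (a ρ : ℂ) (N k l : ℕ) : ℂ :=
  ∑ j ∈ Finset.range (k + 1),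
    (poch (-(k : ℂ)) j * poch (-(l : ℂ)) j * poch ((k : ℂ) + 2 * a - 1) j) /
      (poch (a + ρ) j * poch (-(N : ℂ)) j * (Nat.factorial j : ℂ))

/-- The basis `aₖ(x) = (x+a)ₖ (x+1-a-N)_{N-k}`. -/
noncomputable def aFun (a : ℂ) (N k : ℕ) (x : ℂ) : ℂ :=
  poch (x + a) k * poch (x + 1 - a - N) (N - k)

/-- The basis `cₗ(x) = (ρ-x)ₗ`. -/
noncomputable def cFun (ρ : ℂ) (l : ℕ) (x : ℂ) : ℂ := poch (ρ - x) l

lemma poch_zero (z : ℂ) : poch z 0 = 1 := by simp [poch]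

lemma poch_succ (z : ℂ) (m : ℕ) : poch z (m + 1) = poch z m * (z + m) := by
  simp [poch, Finset.prod_range_succ]

lemma poch_add (z : ℂ) (m n : ℕ) : poch z (m + n) = poch z m * poch (z + m) n := by
  simp [poch, Finset.prod_range_add, add_assoc]

lemma poch_succ' (z : ℂ) (m : ℕ) : poch z (m + 1) = z * poch (z + 1) m := by
  rw [add_comm, poch_add]
  simp [poch]

/-- Reflection of the Pochhammer symbol. -/
lemma poch_reflect (z w : ℂ) (m : ℕ) (h : z + w + m = 1) :
    poch z m = (-1) ^ m * poch w m := by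
  induction m generalizing z with
  | zero => simp [poch_zero]
  | succ m ih =>
    push_cast at h
    rw [poch_succ', poch_succ, ih (z + 1) (by linear_combination h), pow_succ]
    linear_combination ((-1) ^ m * poch w m) * h

lemma poch_neg_nat (n j : ℕ) :
    poch (-(n : ℂ)) j = (-1) ^ j * (j.factorial : ℂ) * (n.choose j : ℂ) := by
  induction j with
  | zero => simp [poch_zero]
  | succ j ih =>
    have h : (n.choose (j + 1) : ℂ) * (j + 1) = n.choose j * ((n : ℂ) - j) := by
      rcases le_or_gt j n with hj | hj
      · have := congrArg (Nat.cast (R := ℂ)) (Nat.choose_succ_right_eq n j)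
        push_cast [Nat.cast_sub hj] at this
        exact this
      · simp [Nat.choose_eq_zero_of_lt hj, Nat.choose_eq_zero_of_lt (hj.trans (Nat.lt_succ_self j))]
    rw [poch_succ, ih, Nat.factorial_succ, pow_succ]
    push_cast
    linear_combination ((-1) ^ j * (j.factorial : ℂ)) * h

/-- The Chu–Vandermonde sum, cleared of denominators. -/
lemma chu_vandermonde (M : ℕ) (y c : ℂ) :
    ∑ m ∈ Finset.range (M + 1),
      (-1) ^ m * (M.choose m : ℂ) * poch y m * poch (c + m) (M - m) = poch (c - y) M := by
  induction M generalizing y c with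
  | zero => simp [poch_zero]
  | succ M ih =>
    have h₁ : ∑ m ∈ Finset.range (M + 1 + 1),
        (-1) ^ m * (M.choose m : ℂ) * poch y m * poch (c + m) (M + 1 - m)
          = (c + M) * poch (c - y) M := by
      rw [Finset.sum_range_succ, Nat.choose_succ_self, ← ih, Finset.mul_sum]
      simp only [Nat.cast_zero, mul_zero, zero_mul, add_zero]
      refine Finset.sum_congr rfl fun m hm => ?_
      have hm' : m ≤ M := Nat.lt_succ_iff.mp (Finset.mem_range.mp hm)
      rw [Nat.succ_sub hm', poch_succ, Nat.cast_sub hm']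
      ring
    rw [Finset.sum_range_succ'] at h₁ ⊢
    have h₂ : ∑ m ∈ Finset.range (M + 1),
        (-1) ^ (m + 1) * (M.choose m : ℂ) * poch y (m + 1) *
          poch (c + (m + 1 : ℕ)) (M + 1 - (m + 1)) = -y * poch (c - y) M := by
      have := ih (y + 1) (c + 1)
      rw [show c + 1 - (y + 1) = c - y by ring] at this
      rw [← this, Finset.mul_sum]
      refine Finset.sum_congr rfl fun m _ => ?_
      rw [poch_succ', Nat.add_sub_add_right, pow_succ]
      push_cast
      rw [show c + ((m : ℂ) + 1) = c + 1 + m by ring]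
      ring
    have h₃ : ∀ m, ((M + 1).choose (m + 1) : ℂ) = M.choose m + M.choose (m + 1) := fun m => by
      rw [Nat.choose_succ_succ]; push_cast; rfl
    simp only [h₃, mul_add, add_mul, Finset.sum_add_distrib, h₂]
    simp only [Nat.choose_zero_right] at h₁ ⊢
    rw [poch_succ]
    linear_combination h₁

/-- The partial sums behind the recursion in `k` for the Saalschütz sum. -/
lemma saalschutz_partial (A B c e : ℂ) (he : e = A + B + 1 - c) (k n : ℕ) (hn : n ≤ k) :
    ∑ j ∈ Finset.range (n + 1),
      ((-1) ^ j * ((k + 1).choose j : ℂ) * poch A j * poch B j * poch (c + j) (k + 1 - j) *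
          poch (e - (k + 1 : ℕ) + j) (k + 1 - j)
        + (c - A + k) * (c - B + k) * ((-1) ^ j * (k.choose j : ℂ) * poch A j * poch B j *
          poch (c + j) (k - j) * poch (e - k + j) (k - j)))
      = (-1) ^ n * (k.choose n : ℂ) * poch A (n + 1) * poch B (n + 1) *
          poch (c + n) (k - n) * poch (e - k + n) (k - n) := by
  induction n with
  | zero =>
    have : poch (e - (k + 1 : ℕ) + (0 : ℕ)) (k + 1) =
        (e - k - 1) * poch (e - k + (0 : ℕ)) k := by
      rw [poch_succ']; push_cast; ring_nf
    simp only [zero_add, Finset.sum_range_one, Nat.choose_zero_right, Nat.sub_zero, this,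
      poch_succ (c + (0 : ℕ)), poch_succ A, poch_succ B, poch_zero]
    rw [he]
    push_cast
    ring
  | succ n ih =>
    obtain ⟨p, rfl⟩ := Nat.exists_eq_add_of_le hn
    rw [Finset.sum_range_succ, ih (by omega)]
    have h₁ : n + 1 + p + 1 - (n + 1) = p + 1 := by omega
    have h₂ : n + 1 + p - n = p + 1 := by omega
    have h₃ : n + 1 + p - (n + 1) = p := by omega
    have h₄ : ((n + 1 + p + 1).choose (n + 1) : ℂ)
        = (n + 1 + p).choose n + (n + 1 + p).choose (n + 1) := by
      rw [Nat.choose_succ_succ]; push_cast; rfl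
    have h₅ : ((n + 1 + p).choose (n + 1) : ℂ) * (n + 1) = (n + 1 + p).choose n * (p + 1) := by
      have := congrArg (Nat.cast (R := ℂ)) (Nat.choose_succ_right_eq (n + 1 + p) n)
      rw [h₂] at this
      exact_mod_cast this
    rw [h₁, h₂, h₃, h₄, poch_succ' (c + n), poch_succ (c + (n + 1 : ℕ)),
      poch_succ' (e - (n + 1 + p : ℕ) + n), poch_succ' (e - (n + 1 + p + 1 : ℕ) + (n + 1 : ℕ)),
      poch_succ A (n + 1), poch_succ B (n + 1),
      show c + n + 1 = c + (n + 1 : ℕ) by push_cast; ring,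
      show e - (n + 1 + p : ℕ) + n + 1 = e - (n + 1 + p : ℕ) + (n + 1 : ℕ) by push_cast; ring,
      show e - (n + 1 + p + 1 : ℕ) + (n + 1 : ℕ) + 1 = e - (n + 1 + p : ℕ) + (n + 1 : ℕ) by
        push_cast; ring, pow_succ]
    generalize poch (c + (n + 1 : ℕ)) p = X
    generalize poch (e - (n + 1 + p : ℕ) + (n + 1 : ℕ)) p = Y
    generalize poch A (n + 1) = U
    generalize poch B (n + 1) = V
    generalize ((n + 1 + p).choose n : ℂ) = C at *
    generalize ((n + 1 + p).choose (n + 1) : ℂ) = D at *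
    rw [he]
    push_cast
    linear_combination (-1) ^ n * U * V * X * Y * (A + B - c - p) * h₅

/-- The Pfaff–Saalschütz sum, cleared of denominators. -/
lemma pfaff_saalschutz (A B c e : ℂ) (he : e = A + B + 1 - c) (k : ℕ) :
    ∑ j ∈ Finset.range (k + 1),
      (-1) ^ j * (k.choose j : ℂ) * poch A j * poch B j * poch (c + j) (k - j) *
        poch (e - k + j) (k - j)
      = (-1) ^ k * poch (c - A) k * poch (c - B) k := by
  induction k with
  | zero => simp [poch_zero]
  | succ k ih =>
    have h := saalschutz_partial A B c e he k k le_rfl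
    rw [Finset.sum_add_distrib, ← Finset.mul_sum, ih] at h
    rw [Finset.sum_range_succ, poch_succ (c - A), poch_succ (c - B)]
    simp only [Nat.sub_self, poch_zero, Nat.choose_self, pow_succ] at h ⊢
    linear_combination h

/-- The inner sum over `ℓ` after exchanging the order of summation. -/
lemma chu_vandermonde_choose (N j : ℕ) (hj : j ≤ N) (y b : ℂ) :
    ∑ l ∈ Finset.range (N + 1),
      (-1) ^ l * (N.choose l : ℂ) * (l.choose j : ℂ) * poch y l * poch (b + l) (N - l)
      = (-1) ^ j * (N.choose j : ℂ) * poch y j * poch (b - y) (N - j) := by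
  obtain ⟨M, rfl⟩ := Nat.exists_eq_add_of_le hj
  have h := chu_vandermonde M (y + j) (b + j)
  rw [show b + j - (y + j) = b - y by ring] at h
  rw [Nat.add_sub_cancel_left, ← h, add_assoc, Finset.sum_range_add, Finset.mul_sum,
    Finset.sum_eq_zero, zero_add]
  · refine Finset.sum_congr rfl fun m hm => ?_
    have hc := congrArg (Nat.cast (R := ℂ))
      (Nat.choose_mul (n := j + M) (k := j + m) (s := j) (by omega))
    rw [Nat.add_sub_cancel_left, Nat.add_sub_cancel_left] at hc
    push_cast at hc
    rw [poch_add, Nat.add_sub_add_left, pow_add]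
    push_cast
    rw [← add_assoc b]
    linear_combination (-1) ^ j * (-1) ^ m * poch y j * poch (y + j) m *
      poch (b + j + m) (M - m) * hc
  · intro l hl
    simp [Nat.choose_eq_zero_of_lt (Finset.mem_range.mp hl)]

/-- The Hahn polynomial written with binomial coefficients. -/
lemma hahnQ_eq_sum_choose (a ρ : ℂ) (N k l : ℕ) :
    hahnQ a ρ N k l = ∑ j ∈ Finset.range (k + 1),
      (-1) ^ j * (k.choose j : ℂ) * (l.choose j : ℂ) * poch ((k : ℂ) + 2 * a - 1) j /
        (poch (a + ρ) j * (N.choose j : ℂ)) := by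
  refine Finset.sum_congr rfl fun j _ => ?_
  have hf : (j.factorial : ℂ) ≠ 0 := Nat.cast_ne_zero.mpr j.factorial_ne_zero
  have hs : ((-1 : ℂ)) ^ j ≠ 0 := by simp
  rw [poch_neg_nat, poch_neg_nat, poch_neg_nat]
  refine Eq.trans ?_ (mul_div_mul_left _ _ (mul_ne_zero hs (mul_ne_zero hf hf)))
  congr 1 <;> ring

/-- Overlap formula expanding `aₖ` over the basis `cₗ` with Hahn polynomial coefficients:
`aₖ = (a+ρ)ₖ (1-a-N+ρ)_{N-k} Σ_{ℓ=0}^{N} ((-N)ₗ / (ℓ! (1-a-N+ρ)ₗ)) Qₖ(ℓ) cₗ`. -/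
theorem a_in_terms_of_c (a ρ : ℂ) (N : ℕ)
    (h1 : ∀ j ≤ N, poch (a + ρ) j ≠ 0)
    (h2 : ∀ l ≤ N, poch (1 - a - N + ρ) l ≠ 0)
    (k : ℕ) (hk : k ≤ N) (x : ℂ) :
    aFun a N k x =
      poch (a + ρ) k * poch (1 - a - (N : ℂ) + ρ) (N - k) *
        ∑ l ∈ Finset.range (N + 1),
          (poch (-(N : ℂ)) l / ((Nat.factorial l : ℂ) * poch (1 - a - (N : ℂ) + ρ) l))
            * hahnQ a ρ N k l * cFun ρ l x := by
  set b : ℂ := 1 - a - (N : ℂ) + ρ with hb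
  have hbN : poch b N ≠ 0 := h2 N le_rfl
  have hterm : ∀ l ∈ Finset.range (N + 1),
      (poch (-(N : ℂ)) l / ((Nat.factorial l : ℂ) * poch b l)) * hahnQ a ρ N k l * cFun ρ l x
        = ∑ j ∈ Finset.range (k + 1),
          (-1) ^ j * (k.choose j : ℂ) * poch ((k : ℂ) + 2 * a - 1) j /
            (poch (a + ρ) j * (N.choose j : ℂ) * poch b N) *
          ((-1) ^ l * (N.choose l : ℂ) * (l.choose j : ℂ) * poch (ρ - x) l *
            poch (b + l) (N - l)) := by
    intro l hl
    have hl' : l ≤ N := Nat.lt_succ_iff.mp (Finset.mem_range.mp hl)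
    have hf : (l.factorial : ℂ) ≠ 0 := Nat.cast_ne_zero.mpr l.factorial_ne_zero
    have hbl : poch b l ≠ 0 := h2 l hl'
    have hsplit : poch b N = poch b l * poch (b + l) (N - l) := by
      rw [← poch_add, Nat.add_sub_cancel' hl']
    have hr : poch (b + l) (N - l) ≠ 0 := right_ne_zero_of_mul (hsplit ▸ hbN)
    rw [hahnQ_eq_sum_choose a ρ N k l, poch_neg_nat, cFun, Finset.mul_sum, Finset.sum_mul]
    refine Finset.sum_congr rfl fun j hj => ?_
    have hj' : j ≤ k := Nat.lt_succ_iff.mp (Finset.mem_range.mp hj)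
    have hc : (N.choose j : ℂ) ≠ 0 :=
      Nat.cast_ne_zero.mpr (Nat.choose_pos (hj'.trans hk)).ne'
    have hA := h1 j (hj'.trans hk)
    rw [hsplit]
    field_simp
  rw [Finset.sum_congr rfl hterm, Finset.sum_comm]
  simp only [← Finset.mul_sum]
  have hS := pfaff_saalschutz (ρ - x) ((k : ℂ) + 2 * a - 1) (a + ρ) (a - x + k) (by ring) k
  have hsplit : poch b N = poch b (N - k) * poch (1 - a - k + ρ) k := by
    have := poch_add b (N - k) k
    rw [Nat.sub_add_cancel hk, Nat.cast_sub hk] at this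
    rw [this, hb]
    ring_nf
  have hr : poch (1 - a - k + ρ) k ≠ 0 := right_ne_zero_of_mul (hsplit ▸ hbN)
  have hl : poch b (N - k) ≠ 0 := left_ne_zero_of_mul (hsplit ▸ hbN)
  have hak := h1 k hk
  have hsum : ∀ j ∈ Finset.range (k + 1),
      (-1) ^ j * (k.choose j : ℂ) * poch ((k : ℂ) + 2 * a - 1) j /
            (poch (a + ρ) j * (N.choose j : ℂ) * poch b N) *
          ∑ l ∈ Finset.range (N + 1), ((-1) ^ l * (N.choose l : ℂ) * (l.choose j : ℂ) *
            poch (ρ - x) l * poch (b + l) (N - l))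
        = (-1) ^ k * poch (x + 1 - a - N) (N - k) / (poch (a + ρ) k * poch b N) *
          ((-1) ^ j * (k.choose j : ℂ) * poch (ρ - x) j * poch ((k : ℂ) + 2 * a - 1) j *
            poch (a + ρ + j) (k - j) * poch (a - x + k - k + j) (k - j)) := by
    intro j hj
    have hj' : j ≤ k := Nat.lt_succ_iff.mp (Finset.mem_range.mp hj)
    have hc : (N.choose j : ℂ) ≠ 0 :=
      Nat.cast_ne_zero.mpr (Nat.choose_pos (hj'.trans hk)).ne'
    have hA := h1 j (hj'.trans hk)
    have hAk : poch (a + ρ) k = poch (a + ρ) j * poch (a + ρ + j) (k - j) := by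
      rw [← poch_add, Nat.add_sub_cancel' hj']
    have hAr : poch (a + ρ + j) (k - j) ≠ 0 := right_ne_zero_of_mul (hAk ▸ hak)
    have hx : poch (b - (ρ - x)) (N - j) =
        poch (x + 1 - a - N) (N - k) * ((-1) ^ (k - j) * poch (a - x + k - k + j) (k - j)) := by
      rw [← poch_reflect (x + 1 - a - N + (N - k : ℕ)) _ _
          (by rw [Nat.cast_sub hk, Nat.cast_sub hj']; ring), ← poch_add,
        show N - k + (k - j) = N - j by omega, hb]
      ring_nf
    have hsgn : (-1 : ℂ) ^ k = (-1) ^ j * (-1) ^ (k - j) := by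
      rw [← pow_add, Nat.add_sub_cancel' hj']
    rw [chu_vandermonde_choose N j (hj'.trans hk), hx, hAk, hsgn]
    field_simp
  rw [Finset.sum_congr rfl hsum, ← Finset.mul_sum, hS, hsplit, aFun,
    show a + ρ - (ρ - x) = x + a by ring,
    show a + ρ - ((k : ℂ) + 2 * a - 1) = 1 - a - k + ρ by ring]
  have hsgn : ((-1 : ℂ)) ^ k * (-1) ^ k = 1 := by rw [← mul_pow]; simp
  field_simp
  linear_combination (-(poch (x + a) k * poch (x + 1 - a - N) (N - k))) * hsgn
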